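/- If n is a prime number, then ε(n,g,x,g) > 1 − 2/n for every integer x with 0 ≤ x < q. -/

import Mathlib

open Polynomial

/-- The set of non-successful triples `(s, r, R)`. -/
def failSet (L : Type*) [Field L] [Algebra (ZMod 2) L] (q x : ℕ) (g : L) (D : Set L)
    (Vf : ℕ → Polynomial (ZMod 2)) (Wf : ℕ → L → Polynomial (ZMod 2)) : Set (ℕ × L × L) :=
  {t | t.1 < q ∧ (t.2.1 = 0 ∨ t.2.1 = 1) ∧ t.2.2 ∈ D ∧
    ¬ (aeval t.2.2 (Vf t.1) ≠ 0 ∧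
       aeval t.2.2 (Wf t.1 t.2.1) + (aeval t.2.2 (Vf t.1)) ^ x * (g + t.2.1) = 0)}

/-- The failure probability `ε(n,g,x,g)` = (number of non-successful triples)/(2·q·|D_x|). -/
noncomputable def epsVal (L : Type*) [Field L] [Algebra (ZMod 2) L] (q x : ℕ) (g : L)
    (D : Set L) (Vf : ℕ → Polynomial (ZMod 2)) (Wf : ℕ → L → Polynomial (ZMod 2)) : ℚ :=
  ((failSet L q x g D Vf Wf).ncard : ℚ) / ((2 * q * D.ncard : ℕ) : ℚ)

/-- Evaluating a polynomial over `GF(2)` commutes with iterated Frobenius. -/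
lemma aeval_pow_two_pow {L : Type*} [Field L] [Algebra (ZMod 2) L] (P : Polynomial (ZMod 2))
    (R : L) (j : ℕ) : aeval (R ^ 2 ^ j) P = (aeval R P) ^ 2 ^ j := by
  induction j with
  | zero => simp
  | succ j ih =>
    rw [pow_succ, pow_mul, ← expand_aeval, ZMod.expand_card, map_pow, ih, ← pow_mul]

/-- The conjugates `g ^ 2 ^ j + r`, `j < n`, of `g + r` are distinct. -/
lemma conjugates_add_injective {L : Type*} [Field L] [CharP L 2] {n : ℕ} (hn : 2 ≤ n)
    {g r : L} (hg : orderOf g = 2 ^ n - 1) (hr : r = 0 ∨ r = 1) {i j : ℕ} (hi : i < n)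
    (hj : j < n) (h : (g + r) ^ 2 ^ i = (g + r) ^ 2 ^ j) : i = j := by
  have hr' : ∀ k : ℕ, r ^ 2 ^ k = r := by
    intro k
    rcases hr with rfl | rfl <;> simp
  rw [add_pow_char_pow, add_pow_char_pow, hr', hr', add_left_inj] at h
  have hlt : ∀ k < n, 2 ^ k < orderOf g := by
    intro k hk
    have h1 : 2 ^ k ≤ 2 ^ (n - 1) := Nat.pow_le_pow_right (by norm_num) (by omega)
    have h2 : 2 ^ n = 2 * 2 ^ (n - 1) := by
      rw [← pow_succ']
      congr 1
      omega
    have h3 : 2 ^ 1 ≤ 2 ^ (n - 1) := Nat.pow_le_pow_right (by norm_num) (by omega)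
    omega
  exact Nat.pow_right_injective le_rfl (pow_injOn_Iio_orderOf (hlt i hi) (hlt j hj) h)

/-- Each Frobenius orbit contains at most one success for given `s` and `r`, so successes make up
at most a fraction `1 / n` of all triples. -/
lemma mul_ncard_success_le {L : Type*} [Field L] [Finite L] [Algebra (ZMod 2) L]
    {n : ℕ} (hn : 2 ≤ n) {g : L} (hg : orderOf g = 2 ^ n - 1) (q x : ℕ) {D : Set L}
    (hD : ∀ R ∈ D, ∀ j : ℕ, R ^ 2 ^ j ∈ D)
    (Vf : ℕ → Polynomial (ZMod 2)) (Wf : ℕ → L → Polynomial (ZMod 2)) :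
    ((Set.Iio q ×ˢ ({0, 1} : Set L) ×ˢ D) \ failSet L q x g D Vf Wf).ncard * n ≤
      (Set.Iio q ×ˢ ({0, 1} : Set L) ×ˢ D).ncard := by
  have : CharP L 2 := charP_of_injective_algebraMap (algebraMap (ZMod 2) L).injective 2
  set T := Set.Iio q ×ˢ ({0, 1} : Set L) ×ˢ D with hT
  have hTfin : T.Finite := (Set.finite_Iio q).prod ((Set.toFinite _).prod (Set.toFinite _))
  have hsucc : ∀ t ∈ T \ failSet L q x g D Vf Wf, aeval t.2.2 (Vf t.1) ≠ 0 ∧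
      aeval t.2.2 (Wf t.1 t.2.1) = aeval t.2.2 (Vf t.1) ^ x * (g + t.2.1) := by
    rintro ⟨s, r, R⟩ ⟨⟨hs, hr, hR⟩, hF⟩
    by_contra hcon
    refine hF ⟨hs, hr, hR, fun h => hcon ⟨h.1, ?_⟩⟩
    exact CharTwo.add_eq_zero.mp h.2
  have key : ((T \ failSet L q x g D Vf Wf) ×ˢ Set.Iio n).ncard ≤ T.ncard := by
    refine Set.ncard_le_ncard_of_injOn (fun p => (p.1.1, p.1.2.1, p.1.2.2 ^ 2 ^ p.2)) ?_ ?_ hTfin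
    · rintro ⟨⟨s, r, R⟩, j⟩ ⟨⟨⟨hs, hr, hR⟩, -⟩, -⟩
      exact ⟨hs, hr, hD R hR j⟩
    · rintro ⟨⟨s, r, R⟩, j⟩ ⟨ht, hj⟩ ⟨⟨s', r', R'⟩, j'⟩ ⟨ht', hj'⟩ heq
      simp only [Prod.mk.injEq] at heq
      obtain ⟨rfl, rfl, hRR⟩ := heq
      obtain ⟨hV, hW⟩ := hsucc _ ht
      obtain ⟨hV', hW'⟩ := hsucc _ ht'
      simp only at hV hW hV' hW'
      have hVV : aeval R (Vf s) ^ 2 ^ j = aeval R' (Vf s) ^ 2 ^ j' := by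
        rw [← aeval_pow_two_pow, ← aeval_pow_two_pow, hRR]
      have hWW : aeval R (Wf s r) ^ 2 ^ j = aeval R' (Wf s r) ^ 2 ^ j' := by
        rw [← aeval_pow_two_pow, ← aeval_pow_two_pow, hRR]
      rw [hW, hW', mul_pow, mul_pow, pow_right_comm, hVV, pow_right_comm _ x] at hWW
      have hconj := mul_left_cancel₀ (pow_ne_zero _ (pow_ne_zero _ hV')) hWW
      obtain rfl := conjugates_add_injective hn hg ht.1.2.1 hj hj' hconj
      obtain rfl : R = R' := iterateFrobenius_inj L 2 j (by simpa [iterateFrobenius_def] using hRR)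
      rfl
  rwa [Set.ncard_prod, Set.ncard_Iio_nat] at key

/-- If `n` is prime, then `ε(n,g,x,g) > 1 − 2/n` for every `0 ≤ x < q`. -/
theorem stmt6 {L : Type*} [Field L] [Fintype L] [Algebra (ZMod 2) L]
    (n : ℕ) (hn : 2 ≤ n) (hprime : n.Prime) (hcard : Fintype.card L = 2 ^ n)
    (g : L) (hg : orderOf g = 2 ^ n - 1)
    (x : ℕ) (hx : x < 2 ^ n - 1)
    (Y : Polynomial (ZMod 2)) (hYdeg : Y.degree < (n : WithBot ℕ)) (hYg : aeval g Y = g ^ x)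
    (D : Set L) (hD : D = {β | β ≠ 0 ∧ aeval β Y = β ^ x})
    (Vf : ℕ → Polynomial (ZMod 2)) (Wf : ℕ → L → Polynomial (ZMod 2))
    (hVf : ∀ s < 2 ^ n - 1, (Vf s).degree < (n : WithBot ℕ) ∧ aeval g (Vf s) = g ^ s)
    (hWf : ∀ s < 2 ^ n - 1, ∀ r : L, (r = 0 ∨ r = 1) →
      (Wf s r).degree < (n : WithBot ℕ) ∧ aeval g (Wf s r) = g ^ (x * s) * (g + r)) :
    epsVal L (2 ^ n - 1) x g D Vf Wf > 1 - 2 / (n : ℚ) := by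
  have hq : 0 < 2 ^ n - 1 := by
    have : 2 ^ 1 ≤ 2 ^ n := Nat.pow_le_pow_right (by norm_num) (by omega)
    omega
  have hg0 : g ≠ 0 := by
    rintro rfl
    rw [orderOf_zero] at hg
    omega
  have hgD : g ∈ D := hD ▸ ⟨hg0, hYg⟩
  have hDpos : 0 < D.ncard := (Set.ncard_pos (Set.toFinite D)).mpr ⟨g, hgD⟩
  have hDstable : ∀ R ∈ D, ∀ j : ℕ, R ^ 2 ^ j ∈ D := by
    subst hD
    rintro R ⟨hR0, hR⟩ j
    exact ⟨pow_ne_zero _ hR0, by rw [aeval_pow_two_pow, hR, pow_right_comm]⟩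
  have hle := mul_ncard_success_le hn hg (2 ^ n - 1) x hDstable Vf Wf
  have hsub : failSet L (2 ^ n - 1) x g D Vf Wf ⊆
      Set.Iio (2 ^ n - 1) ×ˢ ({0, 1} : Set L) ×ˢ D := fun t ht => ⟨ht.1, ht.2.1, ht.2.2.1⟩
  have hTfin : (Set.Iio (2 ^ n - 1) ×ˢ ({0, 1} : Set L) ×ˢ D).Finite :=
    (Set.finite_Iio _).prod ((Set.toFinite _).prod (Set.toFinite _))
  have hsum := Set.ncard_sdiff_add_ncard_of_subset hsub hTfin
  have hT : (Set.Iio (2 ^ n - 1) ×ˢ ({0, 1} : Set L) ×ˢ D).ncard =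
      2 * (2 ^ n - 1) * D.ncard := by
    rw [Set.ncard_prod, Set.ncard_prod, Set.ncard_Iio_nat, Set.ncard_pair zero_ne_one]
    ring
  rw [hT] at hle hsum
  have hNpos : 0 < 2 * (2 ^ n - 1) * D.ncard := by positivity
  unfold epsVal
  generalize 2 * (2 ^ n - 1) * D.ncard = N at *
  generalize (failSet L (2 ^ n - 1) x g D Vf Wf).ncard = F at *
  generalize (_ \ _ : Set (ℕ × L × L)).ncard = S at *
  have hN : (0 : ℚ) < N := by exact_mod_cast hNpos
  have hn0 : (0 : ℚ) < n := by exact_mod_cast (by omega : 0 < n)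
  have hle' : (S : ℚ) * n ≤ N := by exact_mod_cast hle
  have hsum' : (S : ℚ) + F = N := by exact_mod_cast hsum
  have hlt : (S : ℚ) / N < 2 / n := by
    rw [div_lt_div_iff₀ hN hn0]
    linarith
  have hF : (F : ℚ) / N = 1 - S / N := by
    rw [← hsum'] at hN ⊢
    field_simp
    ring
  linarith
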